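/- Let w, w′, y ∈ B⁺ with ℰ(y, w, w′) ≠ ∅, and let v ∈ 𝐖 be such that v ≼ w and v ≼ y. Then there exists a sequence (u₁, …, u_m) ∈ ℰ(y, w, w′) with u₁ = v. -/

import Mathlib

/-!
Artin–Tits braid monoid of a finite Coxeter system `(W,S)`, presented with one
generator `𝐰` for each `w ∈ W` and relations `𝐰₁𝐰₂ = 𝐰` when `w = w₁w₂` with
`l(w₁) + l(w₂) = l(w)`.
-/

variable {B : Type*} {W : Type*} [Group W] {M : CoxeterMatrix B}

/-- The defining relations of the braid monoid. -/
def braidRel (cs : CoxeterSystem M W) : FreeMonoid W → FreeMonoid W → Prop := fun a b =>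
  ∃ w₁ w₂ : W, cs.length (w₁ * w₂) = cs.length w₁ + cs.length w₂ ∧
    a = FreeMonoid.of w₁ * FreeMonoid.of w₂ ∧ b = FreeMonoid.of (w₁ * w₂)

/-- The braid monoid `B⁺` of the Coxeter system `cs`. -/
abbrev BraidMonoid (cs : CoxeterSystem M W) := PresentedMonoid (braidRel cs)

/-- The canonical element `𝐰 ∈ B⁺` attached to `w ∈ W`. -/
def bOf (cs : CoxeterSystem M W) (w : W) : BraidMonoid cs := PresentedMonoid.of (braidRel cs) w

/-- The canonical morphism `β : B⁺ → W`, `𝐰 ↦ w`. -/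
noncomputable def bPi (cs : CoxeterSystem M W) : BraidMonoid cs →* W :=
  PresentedMonoid.lift (fun w : W => w) (by
    rintro a b ⟨w₁, w₂, -, rfl, rfl⟩
    simp)

/-- The additive length morphism `l : B⁺ → ℕ` with `l(𝐬) = 1`; recorded as a morphism
to `Multiplicative ℕ`. It sends `𝐰` to `l(w)`. -/
noncomputable def bLen (cs : CoxeterSystem M W) : BraidMonoid cs →* Multiplicative ℕ :=
  PresentedMonoid.lift (fun w : W => Multiplicative.ofAdd (cs.length w)) (by
    rintro a b ⟨w₁, w₂, h, rfl, rfl⟩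
    simp [← ofAdd_add, h])

/-- The set `𝐖 = {b ∈ B⁺ : l(b) = l(β(b))}`, a copy of `W` inside `B⁺`. -/
def bW (cs : CoxeterSystem M W) : Set (BraidMonoid cs) :=
  {b | bLen cs b = Multiplicative.ofAdd (cs.length (bPi cs b))}


/-- `EChain cs F w w' L` says that the list `L = (y₁, …, y_n)` is a chain from `w` to
`w'`: there are `w = w₁, w₂, …, w_{n+1} = w'` with `y_i ≼ w_i` and
`y_i·w_{i+1} = w_i·F(y_i)` for all `i`. Thus `ℰ(y, w, w')` is the set of lists `L`
with product `y` satisfying `EChain cs F w w' L`. -/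
inductive EChain (cs : CoxeterSystem M W) (F : BraidMonoid cs →* BraidMonoid cs) :
    BraidMonoid cs → BraidMonoid cs → List (BraidMonoid cs) → Prop
  | nil (w : BraidMonoid cs) : EChain cs F w w []
  | cons {w w₁ w' y : BraidMonoid cs} {L : List (BraidMonoid cs)} :
      (∃ z, y * z = w) → y * w₁ = w * F y → EChain cs F w₁ w' L →
      EChain cs F w w' (y :: L)

section Coxeter

open CoxeterSystem

open scoped Classical in
/-- The action of the `i`-th simple reflection on `W × ZMod 2`: conjugation on the first factor,
the second factor counting modulo `2` how often the conjugated element is the `i`-th simple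
reflection. -/
noncomputable def inversionStep (cs : CoxeterSystem M W) (i : B) : Function.End (W × ZMod 2) :=
  fun p => (cs.simple i * p.1 * cs.simple i, p.2 + if p.1 = cs.simple i then 1 else 0)

open scoped Classical in
theorem inversionStep_mul_pow (cs : CoxeterSystem M W) (i j : B) (k : ℕ) (p : W × ZMod 2) :
    ((inversionStep cs i * inversionStep cs j) ^ k) p =
      ((cs.simple i * cs.simple j) ^ k * p.1 * ((cs.simple i * cs.simple j) ^ k)⁻¹,
        p.2 + ∑ n ∈ Finset.range (2 * k),
          if p.1 = cs.simple j * (cs.simple i * cs.simple j) ^ n then 1 else 0) := by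
  set r := cs.simple i * cs.simple j with hr
  have hinv : r⁻¹ = cs.simple j * cs.simple i := by simp [hr]
  have hj : ∀ n : ℕ, (r ^ n)⁻¹ * cs.simple j = cs.simple j * r ^ n := by
    intro n
    induction n with
    | zero => simp
    | succ n ih =>
      calc (r ^ (n + 1))⁻¹ * cs.simple j = r⁻¹ * ((r ^ n)⁻¹ * cs.simple j) := by
            rw [pow_succ]; group
        _ = cs.simple j * r ^ (n + 1) := by
            rw [ih, hinv, pow_succ', hr]; simp only [mul_assoc]
  induction k with
  | zero => simp; rfl
  | succ k ih =>
    rw [pow_succ']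
    change inversionStep cs i (inversionStep cs j _) = _
    rw [ih]
    have e1 : (r ^ k * p.1 * (r ^ k)⁻¹ = cs.simple j) ↔ p.1 = cs.simple j * r ^ (2 * k) := by
      rw [two_mul, pow_add, ← mul_assoc, ← hj]
      constructor
      · intro h; rw [← h]; group
      · intro h; rw [h]; group
    have e2 : (cs.simple j * (r ^ k * p.1 * (r ^ k)⁻¹) * cs.simple j = cs.simple i) ↔
        p.1 = cs.simple j * r ^ (2 * k + 1) := by
      have : cs.simple j * r ^ (2 * k + 1) = (r ^ k)⁻¹ * (cs.simple j * r) * r ^ k := by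
        rw [← mul_assoc, hj, show 2 * k + 1 = k + 1 + k by omega, pow_add, pow_succ]
        simp only [mul_assoc]
      rw [this]
      constructor
      · intro h
        have h' : cs.simple j * r = r ^ k * p.1 * (r ^ k)⁻¹ := by
          calc cs.simple j * r = cs.simple j * cs.simple i * cs.simple j := by rw [hr, mul_assoc]
            _ = _ := by rw [← h]; simp [mul_assoc]
        rw [h']
        group
      · intro h; rw [h, hr]; simp [mul_assoc]
    simp only [inversionStep, e1, e2]
    refine Prod.ext ?_ ?_
    · simp only [pow_succ', mul_inv_rev, cs.inv_simple, mul_assoc, hr]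
    · rw [show 2 * (k + 1) = 2 * k + 1 + 1 by omega, Finset.sum_range_succ, Finset.sum_range_succ]
      simp only [add_assoc]

theorem inversionStep_isLiftable (cs : CoxeterSystem M W) : M.IsLiftable (inversionStep cs) := by
  classical
  intro i j
  funext p
  rw [inversionStep_mul_pow]
  have h : (cs.simple i * cs.simple j) ^ M i j = 1 := cs.simple_mul_simple_pow i j
  change _ = p
  refine Prod.ext (by simp) ?_
  rw [two_mul, Finset.sum_range_add]
  simp only [pow_add, h, one_mul]
  rw [CharTwo.add_self_eq_zero, add_zero]

/-- The action of `W` on `W × ZMod 2` extending `inversionStep`. -/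
noncomputable def inversionAction (cs : CoxeterSystem M W) : W →* Function.End (W × ZMod 2) :=
  cs.lift ⟨inversionStep cs, inversionStep_isLiftable cs⟩

theorem inversionAction_simple (cs : CoxeterSystem M W) (i : B) :
    inversionAction cs (cs.simple i) = inversionStep cs i :=
  cs.lift_apply_simple _ i

theorem inversionAction_one (cs : CoxeterSystem M W) (p : W × ZMod 2) :
    inversionAction cs 1 p = p := by
  rw [map_one]; rfl

theorem inversionAction_mul (cs : CoxeterSystem M W) (x y : W) (p : W × ZMod 2) :
    inversionAction cs (x * y) p = inversionAction cs x (inversionAction cs y p) := by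
  rw [map_mul]; rfl

/-- The number of occurrences modulo `2` of `t` among the right inversions of `w`. -/
noncomputable def inversionParity (cs : CoxeterSystem M W) (w t : W) : ZMod 2 :=
  (inversionAction cs w (t, 0)).2

theorem inversionParity_one (cs : CoxeterSystem M W) (t : W) : inversionParity cs 1 t = 0 := by
  rw [inversionParity, inversionAction_one]

theorem inversionAction_apply (cs : CoxeterSystem M W) (w : W) (p : W × ZMod 2) :
    inversionAction cs w p = (w * p.1 * w⁻¹, p.2 + inversionParity cs w p.1) := by
  induction w using cs.simple_induction_left generalizing p with
  | one => simp [inversionAction_one, inversionParity_one]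
  | mul_simple_left w i ih =>
    have key : ∀ q : W × ZMod 2, inversionAction cs (cs.simple i * w) q =
        inversionStep cs i (w * q.1 * w⁻¹, q.2 + inversionParity cs w q.1) := by
      intro q
      rw [inversionAction_mul, inversionAction_simple, ← ih]
    rw [key, show inversionParity cs (cs.simple i * w) p.1 = _ from
      congrArg Prod.snd (key (p.1, 0))]
    simp [inversionStep, mul_assoc, add_assoc]

theorem inversionParity_mul (cs : CoxeterSystem M W) (x y t : W) :
    inversionParity cs (x * y) t =
      inversionParity cs y t + inversionParity cs x (y * t * y⁻¹) := by
  rw [inversionParity, inversionAction_mul, inversionAction_apply, inversionAction_apply]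
  simp

open scoped Classical in
theorem inversionParity_simple (cs : CoxeterSystem M W) (i : B) (t : W) :
    inversionParity cs (cs.simple i) t = if t = cs.simple i then 1 else 0 := by
  simp [inversionParity, inversionAction_simple, inversionStep]

theorem mem_rightInvSeq_of_inversionParity_ne_zero (cs : CoxeterSystem M W) (ω : List B) (t : W)
    (h : inversionParity cs (cs.wordProd ω) t ≠ 0) : t ∈ cs.rightInvSeq ω := by
  induction ω with
  | nil => simp [inversionParity_one] at h
  | cons i ω ih =>
    rw [cs.wordProd_cons, inversionParity_mul, inversionParity_simple] at h
    rw [rightInvSeq, List.mem_cons]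
    split_ifs at h with h'
    · left; rw [← h']; group
    · right; exact ih (by simpa using h)

theorem length_mul_lt_of_inversionParity_ne_zero (cs : CoxeterSystem M W) (w t : W)
    (h : inversionParity cs w t ≠ 0) : cs.length (w * t) < cs.length w := by
  obtain ⟨ω, hω, rfl⟩ := cs.exists_isReduced w
  exact (cs.isRightInversion_of_mem_rightInvSeq hω
    (mem_rightInvSeq_of_inversionParity_ne_zero cs ω t h)).2

theorem inversionParity_ne_zero_iff_isRightDescent (cs : CoxeterSystem M W) (w : W) (i : B) :
    inversionParity cs w (cs.simple i) ≠ 0 ↔ cs.IsRightDescent w i := by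
  refine ⟨length_mul_lt_of_inversionParity_ne_zero cs w _, fun h h0 => ?_⟩
  have h1 : inversionParity cs (w * cs.simple i) (cs.simple i) ≠ 0 := by
    rw [inversionParity_mul, inversionParity_simple]
    simp [h0]
  have h2 := length_mul_lt_of_inversionParity_ne_zero cs _ _ h1
  rw [cs.simple_mul_simple_cancel_right] at h2
  exact absurd h (by unfold IsRightDescent; omega)

/-- A form of the exchange property. -/
theorem length_conj_simple_mul_lt (cs : CoxeterSystem M W) (u z : W) (i : B)
    (hu : ¬ cs.IsLeftDescent u i) (huz : cs.IsLeftDescent (u * z) i) :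
    cs.length (u⁻¹ * cs.simple i * u * z) < cs.length z := by
  rw [← cs.isRightDescent_inv_iff, ← inversionParity_ne_zero_iff_isRightDescent] at hu huz
  rw [mul_inv_rev, inversionParity_mul, not_not.mp hu, zero_add] at huz
  have h := length_mul_lt_of_inversionParity_ne_zero cs _ _ huz
  rw [← cs.length_inv, cs.length_inv z] at h
  simpa [mul_assoc] using h

/-- The prefix (right weak) order on `W`. -/
def IsPrefix (cs : CoxeterSystem M W) (x y : W) : Prop :=
  cs.length x + cs.length (x⁻¹ * y) = cs.length y

theorem isPrefix_mul_iff (cs : CoxeterSystem M W) (x y : W) :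
    IsPrefix cs x (x * y) ↔ cs.length (x * y) = cs.length x + cs.length y := by
  rw [IsPrefix, inv_mul_cancel_left, eq_comm]

theorem isPrefix_refl (cs : CoxeterSystem M W) (x : W) : IsPrefix cs x x := by
  simp [IsPrefix]

theorem one_isPrefix (cs : CoxeterSystem M W) (x : W) : IsPrefix cs 1 x := by
  simp [IsPrefix]

theorem IsPrefix.length_le {cs : CoxeterSystem M W} {x y : W} (h : IsPrefix cs x y) :
    cs.length x ≤ cs.length y := by
  unfold IsPrefix at h; omega

theorem IsPrefix.eq_of_length_le {cs : CoxeterSystem M W} {x y : W} (h : IsPrefix cs x y)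
    (hl : cs.length y ≤ cs.length x) : x = y := by
  unfold IsPrefix at h
  exact inv_mul_eq_one.mp (cs.length_eq_zero_iff.mp (by omega))

theorem IsPrefix.antisymm {cs : CoxeterSystem M W} {x y : W} (h : IsPrefix cs x y)
    (h' : IsPrefix cs y x) : x = y :=
  h.eq_of_length_le h'.length_le

theorem IsPrefix.trans {cs : CoxeterSystem M W} {x y z : W} (h : IsPrefix cs x y)
    (h' : IsPrefix cs y z) : IsPrefix cs x z := by
  unfold IsPrefix at *
  have h1 := cs.length_mul_le (x⁻¹ * y) (y⁻¹ * z)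
  have h2 := cs.length_mul_le x (x⁻¹ * z)
  simp only [mul_assoc, mul_inv_cancel_left] at h1 h2
  omega

theorem IsPrefix.length_mul {cs : CoxeterSystem M W} {a u v : W} (h : IsPrefix cs u v)
    (hv : cs.length (a * v) = cs.length a + cs.length v) :
    cs.length (a * u) = cs.length a + cs.length u := by
  unfold IsPrefix at h
  have h1 := cs.length_mul_le (a * u) (u⁻¹ * v)
  have h2 := cs.length_mul_le a u
  simp only [mul_assoc, mul_inv_cancel_left] at h1
  omega

theorem IsPrefix.mul_left {cs : CoxeterSystem M W} {a u v : W} (h : IsPrefix cs u v)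
    (hv : cs.length (a * v) = cs.length a + cs.length v) : IsPrefix cs (a * u) (a * v) := by
  have h1 := h.length_mul hv
  unfold IsPrefix at *
  rw [mul_inv_rev, mul_assoc, inv_mul_cancel_left]
  omega

theorem IsPrefix.of_mul_left {cs : CoxeterSystem M W} {a u v : W}
    (h : IsPrefix cs (a * u) (a * v)) (hu : cs.length (a * u) = cs.length a + cs.length u)
    (hv : cs.length (a * v) = cs.length a + cs.length v) : IsPrefix cs u v := by
  unfold IsPrefix at *
  rw [mul_inv_rev, mul_assoc, inv_mul_cancel_left] at h
  omega

theorem simple_isPrefix_iff (cs : CoxeterSystem M W) (i : B) (w : W) :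
    IsPrefix cs (cs.simple i) w ↔ cs.IsLeftDescent w i := by
  rw [IsPrefix, cs.isLeftDescent_iff, cs.inv_simple, cs.length_simple, add_comm]

theorem IsPrefix.simple_mul {cs : CoxeterSystem M W} {i : B} {u x : W} (h : IsPrefix cs u x)
    (hi : IsPrefix cs (cs.simple i) x) (hu : ¬ cs.IsLeftDescent u i) :
    IsPrefix cs (cs.simple i * u) x := by
  rw [simple_isPrefix_iff] at hi
  have h1 := length_conj_simple_mul_lt cs u (u⁻¹ * x) i hu (by simpa using hi)
  have h2 := cs.length_mul_le (cs.simple i * u) ((cs.simple i * u)⁻¹ * x)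
  have h3 := cs.length_mul_le (cs.simple i) u
  have h4 := cs.length_simple i
  unfold IsPrefix at *
  simp only [mul_assoc, mul_inv_cancel_left, mul_inv_rev, cs.inv_simple,
    cs.simple_mul_simple_cancel_left] at *
  omega

theorem exists_join_simple (cs : CoxeterSystem M W) {i j : B} {x : W}
    (hi : IsPrefix cs (cs.simple i) x) (hj : IsPrefix cs (cs.simple j) x) :
    ∃ z, IsPrefix cs (cs.simple i) z ∧ IsPrefix cs (cs.simple j) z ∧
      ∀ v, IsPrefix cs (cs.simple i) v → IsPrefix cs (cs.simple j) v → IsPrefix cs z v := by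
  classical
  let P : ℕ → Prop := fun n => ∃ u, cs.length u = n ∧
    ∀ v, IsPrefix cs (cs.simple i) v → IsPrefix cs (cs.simple j) v → IsPrefix cs u v
  have h0 : P 0 := ⟨1, cs.length_one, fun v _ _ => one_isPrefix cs v⟩
  have hb : ∀ n, P n → n ≤ cs.length x := by
    rintro n ⟨u, rfl, hu⟩
    exact (hu x hi hj).length_le
  obtain ⟨z, hz, hz'⟩ := Nat.findGreatest_spec (P := P) (Nat.zero_le (cs.length x)) h0
  have hmax : ∀ k, ((∀ v, IsPrefix cs (cs.simple i) v → IsPrefix cs (cs.simple j) v →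
      IsPrefix cs (cs.simple k) v)) → IsPrefix cs (cs.simple k) z := by
    intro k hk
    rw [simple_isPrefix_iff]
    by_contra hd
    have hP : P (cs.length (cs.simple k * z)) :=
      ⟨_, rfl, fun v hv hv' => (hz' v hv hv').simple_mul (hk v hv hv') hd⟩
    have h1 := Nat.le_findGreatest (hb _ hP) hP
    rw [cs.not_isLeftDescent_iff] at hd
    omega
  exact ⟨z, hmax i fun v hv _ => hv, hmax j fun v _ hv => hv, hz'⟩

theorem exists_simple_isPrefix (cs : CoxeterSystem M W) {x y : W} (h : IsPrefix cs x y)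
    (hne : x ≠ y) : ∃ i, cs.length (x * cs.simple i) = cs.length x + cs.length (cs.simple i) ∧
      IsPrefix cs (x * cs.simple i) y := by
  obtain ⟨i, hi⟩ := cs.exists_leftDescent_of_ne_one (w := x⁻¹ * y)
    (by rwa [Ne, inv_mul_eq_one])
  rw [← simple_isPrefix_iff] at hi
  have hxy : cs.length (x * (x⁻¹ * y)) = cs.length x + cs.length (x⁻¹ * y) := by
    rw [mul_inv_cancel_left]; exact h.symm
  refine ⟨i, hi.length_mul hxy, ?_⟩
  simpa using hi.mul_left hxy

theorem exists_greatest_above (cs : CoxeterSystem M W) (a b : W) (n : ℕ) :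
    ∀ x, cs.length a ≤ cs.length x + n → IsPrefix cs x a → IsPrefix cs x b →
      ∃ g, IsPrefix cs g a ∧ IsPrefix cs g b ∧
        ∀ y, IsPrefix cs x y → IsPrefix cs y a → IsPrefix cs y b → IsPrefix cs y g := by
  induction n with
  | zero =>
    intro x hx hxa hxb
    exact ⟨x, hxa, hxb, fun y _ hya _ => by
      rw [hxa.eq_of_length_le (by omega)]; exact hya⟩
  | succ n ih =>
    intro x hx hxa hxb
    by_cases hex : ∃ i, cs.length (x * cs.simple i) = cs.length x + cs.length (cs.simple i) ∧
        IsPrefix cs (x * cs.simple i) a ∧ IsPrefix cs (x * cs.simple i) b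
    · obtain ⟨i, hi, hia, hib⟩ := hex
      obtain ⟨g, hga, hgb, hg⟩ := ih (x * cs.simple i)
        (by rw [hi, cs.length_simple]; omega) hia hib
      refine ⟨g, hga, hgb, fun y hxy hya hyb => ?_⟩
      by_cases hne : x = y
      · rw [← hne]
        exact ((isPrefix_mul_iff cs x _).mpr hi).trans (hg _ (isPrefix_refl cs _) hia hib)
      obtain ⟨j, hj, hjy⟩ := exists_simple_isPrefix cs hxy hne
      have hja := hjy.trans hya
      have hjb := hjy.trans hyb
      obtain ⟨g', hga', hgb', hg'⟩ := ih (x * cs.simple j)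
        (by rw [hj, cs.length_simple]; omega) hja hjb
      have length_split : ∀ c, IsPrefix cs x c →
          cs.length (x * (x⁻¹ * c)) = cs.length x + cs.length (x⁻¹ * c) := by
        intro c hc; rw [mul_inv_cancel_left]; exact hc.symm
      have descent_of : ∀ k c, IsPrefix cs x c →
          cs.length (x * cs.simple k) = cs.length x + cs.length (cs.simple k) →
          IsPrefix cs (x * cs.simple k) c → IsPrefix cs (cs.simple k) (x⁻¹ * c) := by
        intro k c hc hk hkc
        exact IsPrefix.of_mul_left (by rwa [mul_inv_cancel_left]) hk (length_split c hc)
      obtain ⟨z, hiz, hjz, hz⟩ := exists_join_simple cs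
        (descent_of i a hxa hi hia) (descent_of j a hxa hj hja)
      have hza := hz _ (descent_of i a hxa hi hia) (descent_of j a hxa hj hja)
      have hzb := hz _ (descent_of i b hxb hi hib) (descent_of j b hxb hj hjb)
      have hxz := hza.length_mul (length_split a hxa)
      have hxza : IsPrefix cs (x * z) a := by simpa using hza.mul_left (length_split a hxa)
      have hxzb : IsPrefix cs (x * z) b := by simpa using hzb.mul_left (length_split b hxb)
      have hzg := hg _ (hiz.mul_left hxz) hxza hxzb
      exact (hg' y hjy hya hyb).trans (hg g' (((hiz.mul_left hxz).trans
        (hg' _ (hjz.mul_left hxz) hxza hxzb))) hga' hgb')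
    · refine ⟨x, hxa, hxb, fun y hxy hya hyb => ?_⟩
      by_cases hne : x = y
      · exact hne ▸ isPrefix_refl cs x
      obtain ⟨j, hj, hjy⟩ := exists_simple_isPrefix cs hxy hne
      exact absurd ⟨j, hj, hjy.trans hya, hjy.trans hyb⟩ hex

theorem exists_meet (cs : CoxeterSystem M W) (a b : W) :
    ∃ g, IsPrefix cs g a ∧ IsPrefix cs g b ∧
      ∀ y, IsPrefix cs y a → IsPrefix cs y b → IsPrefix cs y g := by
  obtain ⟨g, h1, h2, h3⟩ := exists_greatest_above cs a b (cs.length a) 1 (by omega)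
    (one_isPrefix cs a) (one_isPrefix cs b)
  exact ⟨g, h1, h2, fun y => h3 y (one_isPrefix cs y)⟩

theorem exists_longest [Finite W] (cs : CoxeterSystem M W) : ∃ w₀, ∀ w, IsPrefix cs w w₀ := by
  obtain ⟨w₀, h₀⟩ := Finite.exists_max cs.length
  have hs : ∀ i, IsPrefix cs (cs.simple i) w₀ := by
    intro i
    rw [simple_isPrefix_iff]
    by_contra hd
    rw [cs.not_isLeftDescent_iff] at hd
    have := h₀ (cs.simple i * w₀)
    omega
  refine ⟨w₀, fun w => ?_⟩
  induction hn : cs.length w generalizing w with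
  | zero => rw [cs.length_eq_zero_iff.mp hn]; exact one_isPrefix cs w₀
  | succ n ih =>
    obtain ⟨i, hi⟩ := cs.exists_leftDescent_of_ne_one (w := w) (by rintro rfl; simp at hn)
    have h1 := cs.isLeftDescent_iff.mp hi
    have h2 := (ih (cs.simple i * w) (by omega)).simple_mul (hs i)
      (cs.isLeftDescent_iff_not_isLeftDescent_mul.mp hi)
    rwa [cs.simple_mul_simple_cancel_left] at h2

/-- For `u, v` in a finite Coxeter group, the prefixes `x` of `v` with `l(ux) = l(u) + l(x)`
have a greatest element. -/
theorem exists_greatest_prefix [Finite W] (cs : CoxeterSystem M W) (u v : W) :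
    ∃ g, IsPrefix cs g v ∧ cs.length (u * g) = cs.length u + cs.length g ∧
      ∀ x, IsPrefix cs x v → cs.length (u * x) = cs.length u + cs.length x →
        IsPrefix cs x g := by
  obtain ⟨w₀, h₀⟩ := exists_longest cs
  have hu : cs.length (u * (u⁻¹ * w₀)) = cs.length u + cs.length (u⁻¹ * w₀) := by
    rw [mul_inv_cancel_left]; exact (h₀ u).symm
  obtain ⟨g, h1, h2, h3⟩ := exists_meet cs (u⁻¹ * w₀) v
  refine ⟨g, h2, h1.length_mul hu, fun x hx hux => h3 x ?_ hx⟩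
  exact IsPrefix.of_mul_left (by rw [mul_inv_cancel_left]; exact h₀ _) hux hu

end Coxeter

section Braid

theorem bOf_mul (cs : CoxeterSystem M W) {u v : W}
    (h : cs.length (u * v) = cs.length u + cs.length v) : bOf cs u * bOf cs v = bOf cs (u * v) := by
  change PresentedMonoid.mk _ _ * PresentedMonoid.mk _ _ = PresentedMonoid.mk _ _
  rw [← map_mul]
  exact PresentedMonoid.mk_eq_mk_of_rel ⟨u, v, h, rfl, rfl⟩

theorem bOf_mul_of_isPrefix (cs : CoxeterSystem M W) {u v : W} (h : IsPrefix cs u v) :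
    bOf cs u * bOf cs (u⁻¹ * v) = bOf cs v := by
  rw [bOf_mul cs (by rw [mul_inv_cancel_left]; exact h.symm), mul_inv_cancel_left]

theorem exists_prod_map_bOf (cs : CoxeterSystem M W) (b : BraidMonoid cs) :
    ∃ l : List W, (l.map (bOf cs)).prod = b := by
  obtain ⟨a, rfl⟩ := PresentedMonoid.surjective_mk b
  refine ⟨FreeMonoid.toList a, ?_⟩
  induction a with
  | one => rfl
  | of x => exact mul_one _
  | mul x y hx hy => rw [FreeMonoid.toList_mul, List.map_append, List.prod_append, hx, hy, map_mul]

theorem BraidMonoid.induction_left (cs : CoxeterSystem M W) {p : BraidMonoid cs → Prop}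
    (b : BraidMonoid cs) (one : p 1) (bOf_mul : ∀ u c, p c → p (bOf cs u * c)) : p b := by
  obtain ⟨l, rfl⟩ := exists_prod_map_bOf cs b
  induction l with
  | nil => exact one
  | cons u l ih => exact bOf_mul u _ ih

theorem bOf_one_mul_bOf (cs : CoxeterSystem M W) (u : W) : bOf cs 1 * bOf cs u = bOf cs u := by
  rw [bOf_mul cs (by simp), one_mul]

theorem bOf_mul_bOf_one (cs : CoxeterSystem M W) (u : W) : bOf cs u * bOf cs 1 = bOf cs u := by
  rw [bOf_mul cs (by simp), mul_one]

/-- The generator attached to `1 ∈ W` is central; it acts as an identity on every nontrivial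
product of generators. -/
theorem bOf_one_mul_comm (cs : CoxeterSystem M W) (b : BraidMonoid cs) :
    bOf cs 1 * b = b * bOf cs 1 := by
  induction b using BraidMonoid.induction_left with
  | one => simp
  | bOf_mul u c ih => rw [mul_assoc, ← ih, ← mul_assoc, ← mul_assoc, bOf_one_mul_bOf,
      bOf_mul_bOf_one]

theorem bOf_one_mul_bOf_mul (cs : CoxeterSystem M W) (u : W) (b : BraidMonoid cs) :
    bOf cs 1 * (bOf cs u * b) = bOf cs u * b := by
  rw [← mul_assoc, bOf_one_mul_bOf]

theorem bOf_mul_bOf_one_mul (cs : CoxeterSystem M W) (u : W) (b : BraidMonoid cs) :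
    bOf cs u * (bOf cs 1 * b) = bOf cs u * b := by
  rw [← mul_assoc, bOf_mul_bOf_one]

theorem bPi_bOf_mul (cs : CoxeterSystem M W) (u : W) (b : BraidMonoid cs) :
    bPi cs (bOf cs u * b) = u * bPi cs b := by
  rw [map_mul]; rfl

theorem bLen_bOf_mul (cs : CoxeterSystem M W) (u : W) (b : BraidMonoid cs) :
    (bLen cs (bOf cs u * b)).toAdd = cs.length u + (bLen cs b).toAdd := by
  rw [map_mul]; rfl

theorem length_bPi_le (cs : CoxeterSystem M W) (b : BraidMonoid cs) :
    cs.length (bPi cs b) ≤ (bLen cs b).toAdd := by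
  induction b using BraidMonoid.induction_left with
  | one => simp
  | bOf_mul u c ih =>
    rw [bPi_bOf_mul, bLen_bOf_mul]
    exact (cs.length_mul_le _ _).trans (by omega)

theorem eq_one_or_eq_bOf_of_mem_bW (cs : CoxeterSystem M W) (b : BraidMonoid cs)
    (hb : b ∈ bW cs) : b = 1 ∨ b = bOf cs (bPi cs b) := by
  have hb' : (bLen cs b).toAdd = cs.length (bPi cs b) := congrArg Multiplicative.toAdd hb
  clear hb
  induction b using BraidMonoid.induction_left with
  | one => exact Or.inl rfl
  | bOf_mul u c ih =>
    right
    rw [bPi_bOf_mul, bLen_bOf_mul] at hb'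
    have h1 := cs.length_mul_le u (bPi cs c)
    have h2 := length_bPi_le cs c
    rw [bPi_bOf_mul, ← bOf_mul cs (by omega)]
    rcases ih (by omega) with rfl | h
    · rw [map_one, mul_one, bOf_mul_bOf_one]
    · rw [← h]

theorem eq_one_of_bOf_mul_eq_bOf_one (cs : CoxeterSystem M W) {u : W} {z : BraidMonoid cs}
    (h : bOf cs u * z = bOf cs 1) : u = 1 := by
  have h1 := congrArg (fun b => (bLen cs b).toAdd) (h.trans (mul_one _).symm)
  simp only [bLen_bOf_mul, map_one, toAdd_one, cs.length_one] at h1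
  exact cs.length_eq_zero_iff.mp (by omega)

variable [Finite W]

/-- The greatest prefix `x` of `v` such that `l(ux) = l(u) + l(x)`. -/
noncomputable def absorbed (cs : CoxeterSystem M W) (u v : W) : W :=
  (exists_greatest_prefix cs u v).choose

theorem absorbed_isPrefix (cs : CoxeterSystem M W) (u v : W) : IsPrefix cs (absorbed cs u v) v :=
  (exists_greatest_prefix cs u v).choose_spec.1

theorem length_mul_absorbed (cs : CoxeterSystem M W) (u v : W) :
    cs.length (u * absorbed cs u v) = cs.length u + cs.length (absorbed cs u v) :=
  (exists_greatest_prefix cs u v).choose_spec.2.1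

theorem isPrefix_absorbed (cs : CoxeterSystem M W) {u v x : W} (hx : IsPrefix cs x v)
    (hux : cs.length (u * x) = cs.length u + cs.length x) : IsPrefix cs x (absorbed cs u v) :=
  (exists_greatest_prefix cs u v).choose_spec.2.2 x hx hux

theorem absorbed_mul (cs : CoxeterSystem M W) {u v : W}
    (huv : cs.length (u * v) = cs.length u + cs.length v) (a : W) :
    absorbed cs u (v * absorbed cs v a) = v * absorbed cs (u * v) a := by
  have hva := length_mul_absorbed cs v a
  set h := absorbed cs (u * v) a with hh
  have hha : IsPrefix cs h a := absorbed_isPrefix cs _ _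
  have huvh : cs.length (u * v * h) = cs.length (u * v) + cs.length h :=
    length_mul_absorbed cs _ _
  have hvh : cs.length (v * h) = cs.length v + cs.length h := by
    have h1 := cs.length_mul_le u (v * h)
    have h2 := cs.length_mul_le v h
    rw [← mul_assoc] at h1
    omega
  apply IsPrefix.antisymm
  · have h1 : IsPrefix cs v (absorbed cs u (v * absorbed cs v a)) :=
      isPrefix_absorbed cs ((isPrefix_mul_iff cs _ _).mpr hva) huv
    have h2 := absorbed_isPrefix cs u (v * absorbed cs v a)
    have h3 := length_mul_absorbed cs u (v * absorbed cs v a)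
    obtain ⟨x, hx⟩ : ∃ x, absorbed cs u (v * absorbed cs v a) = v * x :=
      ⟨v⁻¹ * absorbed cs u (v * absorbed cs v a), by simp⟩
    rw [hx] at h1 h2 h3 ⊢
    rw [isPrefix_mul_iff] at h1
    refine IsPrefix.mul_left ?_ hvh
    refine isPrefix_absorbed cs ((h2.of_mul_left h1 hva).trans (absorbed_isPrefix cs v a)) ?_
    rw [mul_assoc]
    omega
  · refine isPrefix_absorbed cs ((isPrefix_absorbed cs hha hvh).mul_left hva) ?_
    rw [← mul_assoc]
    omega

/-- Left multiplication by the generator attached to `u`, on pairs `(a, m)` standing for the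
product of `a` and `m`; it transfers as much as possible to the first factor. -/
noncomputable def normalStep (cs : CoxeterSystem M W) (u : W) :
    Function.End (W × BraidMonoid cs) :=
  fun p => (u * absorbed cs u p.1, bOf cs ((absorbed cs u p.1)⁻¹ * p.1) * p.2)

theorem normalStep_mul (cs : CoxeterSystem M W) {u v : W}
    (huv : cs.length (u * v) = cs.length u + cs.length v) :
    normalStep cs u * normalStep cs v = normalStep cs (u * v) := by
  funext p
  change normalStep cs u (normalStep cs v p) = _
  obtain ⟨a, m⟩ := p
  simp only [normalStep, absorbed_mul cs huv]
  refine Prod.ext (by simp [mul_assoc]) ?_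
  have hv := absorbed_isPrefix cs v a
  have huv' := absorbed_isPrefix cs (u * v) a
  have hle : IsPrefix cs (absorbed cs (u * v) a) (absorbed cs v a) := by
    refine isPrefix_absorbed cs huv' ?_
    have h1 := length_mul_absorbed cs (u * v) a
    have h2 := cs.length_mul_le u (v * absorbed cs (u * v) a)
    have h3 := cs.length_mul_le v (absorbed cs (u * v) a)
    rw [← mul_assoc] at h2
    omega
  simp only [mul_inv_rev, mul_assoc, inv_mul_cancel_left]
  rw [← mul_assoc, bOf_mul]
  · simp [mul_assoc]
  · unfold IsPrefix at *
    simp only [mul_assoc, mul_inv_cancel_left]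
    omega

/-- The action of the braid monoid extending `normalStep`. -/
noncomputable def normalAction (cs : CoxeterSystem M W) :
    BraidMonoid cs →* Function.End (W × BraidMonoid cs) :=
  PresentedMonoid.lift (normalStep cs) (by
    rintro a b ⟨u, v, h, rfl, rfl⟩
    simpa using normalStep_mul cs h)

theorem normalAction_bOf_mul (cs : CoxeterSystem M W) (u : W) (b : BraidMonoid cs)
    (p : W × BraidMonoid cs) :
    normalAction cs (bOf cs u * b) p = normalStep cs u (normalAction cs b p) := by
  rw [map_mul]; rfl

theorem bOf_normalAction_mul (cs : CoxeterSystem M W) (b : BraidMonoid cs)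
    (p : W × BraidMonoid cs) :
    bOf cs (normalAction cs b p).1 * (normalAction cs b p).2 = b * (bOf cs p.1 * p.2) := by
  induction b using BraidMonoid.induction_left with
  | one => rw [map_one, one_mul]; rfl
  | bOf_mul u c ih =>
    rw [normalAction_bOf_mul, mul_assoc, ← ih]
    simp only [normalStep]
    rw [← bOf_mul cs (length_mul_absorbed cs _ _), mul_assoc, ← mul_assoc (bOf cs (absorbed _ _ _)),
      bOf_mul_of_isPrefix cs (absorbed_isPrefix cs _ _)]

/-- The first factor of the normal form of an element of the braid monoid. -/
noncomputable def head (cs : CoxeterSystem M W) (b : BraidMonoid cs) : W :=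
  (normalAction cs b (1, 1)).1

/-- The product of the remaining factors of the normal form of an element of the braid monoid. -/
noncomputable def tail (cs : CoxeterSystem M W) (b : BraidMonoid cs) : BraidMonoid cs :=
  (normalAction cs b (1, 1)).2

theorem bOf_head_mul_tail (cs : CoxeterSystem M W) (b : BraidMonoid cs) :
    bOf cs (head cs b) * tail cs b = bOf cs 1 * b := by
  rw [head, tail, bOf_normalAction_mul, mul_one, bOf_one_mul_comm]

theorem head_bOf_mul (cs : CoxeterSystem M W) (u : W) (b : BraidMonoid cs) :
    head cs (bOf cs u * b) = u * absorbed cs u (head cs b) := by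
  rw [head, normalAction_bOf_mul]; rfl

theorem tail_bOf_mul (cs : CoxeterSystem M W) (u : W) (b : BraidMonoid cs) :
    tail cs (bOf cs u * b) =
      bOf cs ((absorbed cs u (head cs b))⁻¹ * head cs b) * tail cs b := by
  rw [tail, normalAction_bOf_mul]; rfl

theorem isPrefix_head_bOf_mul (cs : CoxeterSystem M W) (u : W) (b : BraidMonoid cs) :
    IsPrefix cs u (head cs (bOf cs u * b)) := by
  rw [head_bOf_mul, isPrefix_mul_iff]
  exact length_mul_absorbed cs _ _

theorem bOf_dvd_of_isPrefix_head (cs : CoxeterSystem M W) {u : W} {b : BraidMonoid cs}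
    (h : IsPrefix cs u (head cs b)) : ∃ z, bOf cs u * z = bOf cs 1 * b :=
  ⟨bOf cs (u⁻¹ * head cs b) * tail cs b, by
    rw [← mul_assoc, bOf_mul_of_isPrefix cs h, bOf_head_mul_tail]⟩

/-- Left cancellation, up to the generator attached to `1 ∈ W`. -/
theorem bOf_mul_left_cancel (cs : CoxeterSystem M W) {u : W} {b c : BraidMonoid cs}
    (h : bOf cs u * b = bOf cs u * c) : bOf cs 1 * b = bOf cs 1 * c := by
  have key : ∀ b : BraidMonoid cs, bOf cs 1 * b =
      bOf cs (u⁻¹ * head cs (bOf cs u * b)) * tail cs (bOf cs u * b) := by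
    intro b
    rw [head_bOf_mul, tail_bOf_mul, inv_mul_cancel_left, ← mul_assoc,
      bOf_mul_of_isPrefix cs (absorbed_isPrefix cs _ _), bOf_head_mul_tail]
  rw [key b, key c, h]

end Braid

section Chains

theorem EChain.of_mul [Finite W] {cs : CoxeterSystem M W} {F : BraidMonoid cs →* BraidMonoid cs}
    {w w' b : BraidMonoid cs} {u : W} {L : List (BraidMonoid cs)} (hb : b * bOf cs 1 = b)
    (h : EChain cs F w w' (bOf cs u * b :: L)) : EChain cs F w w' (bOf cs u :: b :: L) := by
  cases h with
  | @cons _ w₁ _ _ _ hdvd heq hL =>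
    obtain ⟨z, rfl⟩ := hdvd
    refine EChain.cons (w₁ := b * z * F (bOf cs u)) ⟨b * z, by rw [mul_assoc]⟩
      (by simp only [mul_assoc]) (EChain.cons ⟨z * F (bOf cs u), by rw [mul_assoc]⟩ ?_ hL)
    have h1 : bOf cs u * (b * w₁) = bOf cs u * (b * z * F (bOf cs u) * F b) := by
      simpa only [map_mul, mul_assoc] using heq
    have h2 := bOf_mul_left_cancel cs h1
    have h3 : ∀ c, bOf cs 1 * (b * c) = b * c := fun c => by
      rw [← mul_assoc, bOf_one_mul_comm, hb]
    simpa only [mul_assoc, h3] using h2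

theorem EChain.of_prod_map_bOf [Finite W] {cs : CoxeterSystem M W}
    {F : BraidMonoid cs →* BraidMonoid cs} {w' : BraidMonoid cs} {L : List (BraidMonoid cs)}
    (l : List W) : ∀ {w : BraidMonoid cs}, EChain cs F w w' ((l.map (bOf cs)).prod :: L) →
      EChain cs F w w' (l.map (bOf cs) ++ L) := by
  induction l with
  | nil =>
    rintro w (_ | ⟨-, heq, hL⟩)
    simp only [List.map_nil, List.prod_nil, one_mul, map_one, mul_one] at heq
    simpa [← heq] using hL
  | cons u l ih =>
    intro w h
    cases l with
    | nil => simpa using h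
    | cons v l =>
      rw [List.map_cons, List.prod_cons] at h
      have hb : ((v :: l).map (bOf cs)).prod * bOf cs 1 = ((v :: l).map (bOf cs)).prod := by
        rw [← bOf_one_mul_comm, List.map_cons, List.prod_cons, bOf_one_mul_bOf_mul]
      cases h.of_mul hb with
      | cons hdvd heq hL => exact EChain.cons hdvd heq (ih hL)

theorem EChain.exists_map_bOf [Finite W] {cs : CoxeterSystem M W}
    {F : BraidMonoid cs →* BraidMonoid cs} {w w' : BraidMonoid cs} {L : List (BraidMonoid cs)}
    (h : EChain cs F w w' L) :
    ∃ l : List W, (l.map (bOf cs)).prod = L.prod ∧ EChain cs F w w' (l.map (bOf cs)) := by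
  induction h with
  | nil w => exact ⟨[], rfl, EChain.nil w⟩
  | @cons w w₁ w' y L hdvd heq _ ih =>
    obtain ⟨l, hl, hc⟩ := ih
    obtain ⟨k, rfl⟩ := exists_prod_map_bOf cs y
    refine ⟨k ++ l, by simp [hl], ?_⟩
    rw [List.map_append]
    exact EChain.of_prod_map_bOf k (EChain.cons hdvd heq hc)

theorem EChain.exists_cons_bOf [Finite W] {cs : CoxeterSystem M W}
    {F : BraidMonoid cs →* BraidMonoid cs} (σ : MulAut W)
    (hF : ∀ u : W, F (bOf cs u) = bOf cs (σ u)) {w' : BraidMonoid cs} (l : List W) :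
    ∀ {w : BraidMonoid cs} {u : W}, EChain cs F w w' (l.map (bOf cs)) →
      (∃ z, bOf cs u * z = bOf cs 1 * w) →
      (∃ z, bOf cs u * z = bOf cs 1 * (l.map (bOf cs)).prod) →
      ∃ L, bOf cs u * L.prod = bOf cs 1 * (l.map (bOf cs)).prod ∧
        EChain cs F (bOf cs 1 * w) w' (bOf cs u :: L) := by
  have hF1 : F (bOf cs 1) = bOf cs 1 := by rw [hF, map_one]
  induction l with
  | nil =>
    rintro w u (_ | _) - ⟨z, hz⟩
    simp only [List.map_nil, List.prod_nil, mul_one] at hz ⊢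
    obtain rfl := eq_one_of_bOf_mul_eq_bOf_one cs hz
    refine ⟨[], by simp, EChain.cons (w₁ := w') ⟨w', rfl⟩ ?_ (EChain.nil w')⟩
    rw [hF1, mul_assoc, ← bOf_one_mul_comm, ← mul_assoc, bOf_one_mul_bOf]
  | cons a l ih =>
    rintro w u (_ | ⟨⟨t, rfl⟩, heq, hl⟩) ⟨z, hz⟩ ⟨z', hz'⟩
    rename_i w₁
    simp only [List.map_cons, List.prod_cons, bOf_one_mul_bOf_mul] at hz hz' ⊢
    set y := (l.map (bOf cs)).prod with hy
    obtain ⟨m, hmw, hmy, hm⟩ := exists_meet cs (head cs (bOf cs a * t)) (head cs (bOf cs a * y))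
    have ham : IsPrefix cs a m :=
      hm a (isPrefix_head_bOf_mul cs a t) (isPrefix_head_bOf_mul cs a y)
    have hum : IsPrefix cs u m :=
      hm u (hz ▸ isPrefix_head_bOf_mul cs u z) (hz' ▸ isPrefix_head_bOf_mul cs u z')
    obtain ⟨x, hx⟩ := bOf_dvd_of_isPrefix_head cs hmw
    obtain ⟨x', hx'⟩ := bOf_dvd_of_isPrefix_head cs hmy
    rw [bOf_one_mul_bOf_mul] at hx hx'
    have hma := bOf_mul_of_isPrefix cs ham
    have hmu := bOf_mul_of_isPrefix cs hum
    have hx1 : bOf cs (a⁻¹ * m) * (x * F (bOf cs a)) = bOf cs 1 * w₁ := by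
      rw [← bOf_one_mul_bOf_mul]
      refine bOf_mul_left_cancel cs (u := a) ?_
      rw [heq, ← hx, ← hma]
      simp only [mul_assoc]
    have hx1' : bOf cs (a⁻¹ * m) * x' = bOf cs 1 * y := by
      rw [← bOf_one_mul_bOf_mul]
      refine bOf_mul_left_cancel cs (u := a) ?_
      rw [← hx', ← hma, mul_assoc]
    obtain ⟨L, hLy, hLc⟩ := ih hl ⟨_, hx1⟩ ⟨_, hx1'⟩
    refine ⟨bOf cs (u⁻¹ * m) :: L, ?_, ?_⟩
    · rw [List.prod_cons, ← mul_assoc, hmu, ← hma, mul_assoc, hLy, bOf_mul_bOf_one_mul]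
    · refine EChain.of_mul (bOf_mul_bOf_one cs _) ?_
      rw [hmu]
      obtain _ | ⟨-, heq', hL⟩ := hLc
      refine EChain.cons ⟨x, hx⟩ ?_ hL
      rw [← hma, mul_assoc, heq', map_mul, mul_assoc, bOf_mul_bOf_one_mul, ← mul_assoc, heq]
      simp only [mul_assoc]

end Chains

/-- If `ℰ(y, w, w') ≠ ∅` and `v ∈ 𝐖` divides both `w` and `y` on the
left, then some sequence in `ℰ(y, w, w')` starts with `v`. -/
theorem stmt6 [Finite W] (cs : CoxeterSystem M W)
    (σ : MulAut W) (hσ : σ '' Set.range cs.simple = Set.range cs.simple)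
    (F : BraidMonoid cs ≃* BraidMonoid cs)
    (hF : ∀ u : W, F (bOf cs u) = bOf cs (σ u))
    (w w' y v : BraidMonoid cs)
    (hE : ∃ L : List (BraidMonoid cs), L.prod = y ∧ EChain cs F.toMonoidHom w w' L)
    (hv : v ∈ bW cs) (hvw : ∃ z, v * z = w) (hvy : ∃ z, v * z = y) :
    ∃ L : List (BraidMonoid cs),
      (v :: L).prod = y ∧ EChain cs F.toMonoidHom w w' (v :: L) := by
  obtain ⟨L, rfl, hL⟩ := hE
  rcases eq_one_or_eq_bOf_of_mem_bW cs v hv with rfl | hv'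
  · exact ⟨L, by simp, EChain.cons ⟨w, one_mul w⟩ (by simp) hL⟩
  rw [hv'] at hvw hvy ⊢
  obtain ⟨z, rfl⟩ := hvw
  obtain ⟨z', hz'⟩ := hvy
  obtain ⟨l, hl, hc⟩ := hL.exists_map_bOf
  obtain ⟨L', hL', hc'⟩ := EChain.exists_cons_bOf σ hF l (u := bPi cs v) hc
    ⟨z, (bOf_one_mul_bOf_mul cs _ z).symm⟩
    ⟨z', by rw [hl, ← hz', bOf_one_mul_bOf_mul]⟩
  rw [hl, ← hz', bOf_one_mul_bOf_mul, hz'] at hL'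
  rw [bOf_one_mul_bOf_mul] at hc'
  exact ⟨L', by rw [List.prod_cons, hL'], hc'⟩
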